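/- arXiv:1912.05297 — 2 statements merged into one kernel-verified Lean document; each statement's English description precedes it below -/
import Mathlib

section
/- Let R be a unital ring with involution (a *-ring). Let u, v, w ∈ R be unitary elements ((star x) * x = 1 = x * (star x) for x ∈ {u,v,w}) such that for every ordered pair (x, y) of distinct elements of {u, v, w} one has x * y = -(y * x) and x * (star y) = -((star y) * x). Then (star u) * v * (star u) * w * (star w) * u * (star u) * w * (star v) * u * (star w) * u = -1. -/
/-- Fermi statistics computation: if `u`, `v`, `w` are unitaries in a *-ring that
pairwise graded-anticommute (for every ordered pair `(x, y)` of distinct elements of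
`{u, v, w}` one has `x * y = -(y * x)` and `x * star y = -(star y * x)`), then the
statistics word `star u * v * star u * w * star w * u * star u * w * star v * u * star w * u`
equals `-1`. -/
theorem stmt4 {R : Type*} [Ring R] [StarRing R] (u v w : R)
    (hu1 : star u * u = 1) (hu2 : u * star u = 1)
    (hv1 : star v * v = 1) (hv2 : v * star v = 1)
    (hw1 : star w * w = 1) (hw2 : w * star w = 1)
    (huv : u * v = -(v * u)) (hvu : v * u = -(u * v))
    (husv : u * star v = -(star v * u)) (hvsu : v * star u = -(star u * v))
    (huw : u * w = -(w * u)) (hwu : w * u = -(u * w))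
    (husw : u * star w = -(star w * u)) (hwsu : w * star u = -(star u * w))
    (hvw : v * w = -(w * v)) (hwv : w * v = -(v * w))
    (hvsw : v * star w = -(star w * v)) (hwsv : w * star v = -(star v * w)) :
    star u * v * star u * w * star w * u * star u * w * star v * u * star w * u = -1 := by
  have hsusv : star u * star v = -(star v * star u) := by
    simpa only [star_mul, star_neg] using congrArg star hvu
  calc star u * v * star u * w * star w * u * star u * w * star v * u * star w * u
      = star u * v * star u * (w * star w) * (u * star u) * (w * star v) * u * star w * u := by
        noncomm_ring
    _ = -(star u * v * star u * star v * (w * u) * star w * u) := by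
        rw [hw2, hu2, hwsv]; noncomm_ring
    _ = star u * v * (star u * star v) * u * (w * star w) * u := by
        rw [hwu]; noncomm_ring
    _ = -(star u * (v * star v) * (star u * u) * u) := by
        rw [hsusv, hw2]; noncomm_ring
    _ = -1 := by rw [hv2, hu1, mul_one, mul_one, hu1]
end

section
/- Let n ≥ 1, equip ℝⁿ (as EuclideanSpace ℝ (Fin n)) with Lebesgue measure μ, and let G ⊆ ℝⁿ be an open bounded set whose topological frontier has μ-measure zero. Then the set of (equivalence classes in L²(μ, ℂ) of) functions of the form f + g, where f and g are smooth compactly supported functions ℝⁿ → ℂ with tsupport f ⊆ G and tsupport g ⊆ (closure G)ᶜ, is dense in L²(μ, ℂ). -/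
open MeasureTheory

/-- The `L²` classes of smooth functions with compact support contained in `U`. -/
def MeasureTheory.Lp.smoothCompactlySupported {E : Type*} [NormedAddCommGroup E]
    [NormedSpace ℝ E] [MeasurableSpace E] (μ : Measure E) (U : Set E) :
    Submodule ℂ (Lp ℂ 2 μ) where
  carrier := {h | ∃ f : E → ℂ, ContDiff ℝ (⊤ : ℕ∞) f ∧ HasCompactSupport f ∧ tsupport f ⊆ U ∧
    h =ᵐ[μ] f}
  zero_mem' := ⟨0, contDiff_const, .zero, by simp, Lp.coeFn_zero ..⟩
  add_mem' := by
    rintro a b ⟨f, hf, hfc, hfU, haf⟩ ⟨g, hg, hgc, hgU, hbg⟩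
    exact ⟨f + g, hf.add hg, hfc.add hgc, (tsupport_add f g).trans (Set.union_subset hfU hgU),
      (Lp.coeFn_add a b).trans (haf.add hbg)⟩
  smul_mem' := by
    rintro c a ⟨f, hf, hfc, hfU, haf⟩
    exact ⟨c • f, hf.const_smul c, hfc.smul_left (f := fun _ ↦ c),
      (tsupport_smul_subset_right (fun _ ↦ c) f).trans hfU,
      (Lp.coeFn_smul c a).trans (haf.const_smul c)⟩

open Lp

/-- An `L²` function orthogonal to all smooth functions with compact support in an open set `U`
vanishes almost everywhere on `U`. -/
theorem MeasureTheory.Lp.ae_eq_zero_of_mem_smoothCompactlySupported_orthogonal {E : Type*}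
    [NormedAddCommGroup E] [NormedSpace ℝ E] [FiniteDimensional ℝ E] [MeasurableSpace E]
    [BorelSpace E] {μ : Measure E} [IsLocallyFiniteMeasure μ] {U : Set E} (hU : IsOpen U)
    {h : Lp ℂ 2 μ} (hh : h ∈ (smoothCompactlySupported μ U)ᗮ) :
    ∀ᵐ x ∂μ, x ∈ U → h x = 0 := by
  have hloc : LocallyIntegrable h μ := (Lp.memLp h).locallyIntegrable (by norm_num)
  refine hU.ae_eq_zero_of_integral_contDiff_smul_eq_zero (hloc.locallyIntegrableOn U)
    fun g hg hgc hgU ↦ ?_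
  have hsupp : Function.support (fun x ↦ (g x : ℂ)) = Function.support g := by
    ext; simp
  have hcont : ContDiff ℝ (⊤ : ℕ∞) (fun x ↦ (g x : ℂ)) := Complex.ofRealCLM.contDiff.comp hg
  have hcpt : HasCompactSupport (fun x ↦ (g x : ℂ)) := hgc.comp_left Complex.ofReal_zero
  have hmem : MemLp (fun x ↦ (g x : ℂ)) 2 μ := hcont.continuous.memLp_of_hasCompactSupport hcpt
  have key := (Submodule.mem_orthogonal _ _).1 hh hmem.toLp
    ⟨_, hcont, hcpt, by rwa [tsupport, hsupp], hmem.coeFn_toLp⟩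
  rw [← key, L2.inner_def]
  refine integral_congr_ae ?_
  filter_upwards [hmem.coeFn_toLp] with x hx
  simp [hx, mul_comm]

/-- Density claim underlying twisted Haag duality: for an open bounded set
`G ⊆ ℝⁿ` (`n ≥ 1`) whose frontier is Lebesgue-null, the L² classes of sums `f + g` of
smooth compactly supported functions with `tsupport f ⊆ G` and
`tsupport g ⊆ (closure G)ᶜ` are dense in `L²(ℝⁿ, ℂ)`. -/
theorem stmt14 (n : ℕ) (hn : 1 ≤ n)
    (G : Set (EuclideanSpace ℝ (Fin n))) (hGo : IsOpen G)
    (hGb : Bornology.IsBounded G)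
    (hGf : volume (frontier G) = 0) :
    Dense {h : Lp ℂ 2 (volume : Measure (EuclideanSpace ℝ (Fin n))) |
      ∃ f g : EuclideanSpace ℝ (Fin n) → ℂ,
        ContDiff ℝ (⊤ : ℕ∞) f ∧ HasCompactSupport f ∧ tsupport f ⊆ G ∧
        ContDiff ℝ (⊤ : ℕ∞) g ∧ HasCompactSupport g ∧ tsupport g ⊆ (closure G)ᶜ ∧
        (h : EuclideanSpace ℝ (Fin n) → ℂ) =ᵐ[volume] f + g} := by
  have hdense : Dense ((smoothCompactlySupported volume G ⊔
      smoothCompactlySupported volume (closure G)ᶜ : Submodule ℂ _) :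
      Set (Lp ℂ 2 (volume : Measure (EuclideanSpace ℝ (Fin n))))) := by
    rw [Submodule.dense_iff_topologicalClosure_eq_top, Submodule.topologicalClosure_eq_top_iff,
      ← Submodule.inf_orthogonal, Submodule.eq_bot_iff]
    rintro h ⟨hG, hGc⟩
    refine (Lp.eq_zero_iff_ae_eq_zero).2 ?_
    filter_upwards [ae_eq_zero_of_mem_smoothCompactlySupported_orthogonal hGo hG,
      ae_eq_zero_of_mem_smoothCompactlySupported_orthogonal isClosed_closure.isOpen_compl hGc,
      measure_eq_zero_iff_ae_notMem.1 hGf] with x hxG hxGc hxf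
    by_cases hx : x ∈ G
    · exact hxG hx
    · exact hxGc fun hxc ↦ hxf (hGo.frontier_eq ▸ ⟨hxc, hx⟩)
  refine hdense.mono fun h hh ↦ ?_
  obtain ⟨a, ⟨f, hf, hfc, hfG, haf⟩, b, ⟨g, hg, hgc, hgG, hbg⟩, rfl⟩ := Submodule.mem_sup.1 hh
  exact ⟨f, g, hf, hfc, hfG, hg, hgc, hgG, (Lp.coeFn_add a b).trans (haf.add hbg)⟩
end
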